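/- arXiv:1603.07463 — 2 statements merged into one kernel-verified Lean document; each statement's English description precedes it below -/
import Mathlib

section
/- The first-order hydrostatic reconstruction finite volume scheme exactly preserves every lake-at-rest steady state, including ones with dry zones. Precisely: let g > 0, let Δt, Δx > 0, let F : ℝ² × ℝ² → ℝ² be a numerical flux which is consistent, i.e. F((h, h·u), (h, h·u)) = (h·u, h·u² + g·h²/2) for all h ≥ 0 and u ∈ ℝ. Let z : ℤ → ℝ be a topography, C ∈ ℝ, and define the lake-at-rest data hᵢ = max(C − zᵢ, 0) and uᵢ = 0 for all i ∈ ℤ (so the discharge qᵢ = hᵢuᵢ = 0). With first-order interface values (h_{i+1/2−}, u_{i+1/2−}, z_{i+1/2−}) = (hᵢ, uᵢ, zᵢ) and (h_{i+1/2+}, u_{i+1/2+}, z_{i+1/2+}) = (h_{i+1}, u_{i+1}, z_{i+1}), define the hydrostatically reconstructed heights h_{i+1/2L} = max(h_{i+1/2−} + z_{i+1/2−} − max(z_{i+1/2−}, z_{i+1/2+}), 0), h_{i+1/2R} = max(h_{i+1/2+} + z_{i+1/2+} − max(z_{i+1/2−}, z_{i+1/2+}), 0), reconstructed states U_{i+1/2L}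 = (h_{i+1/2L}, h_{i+1/2L}·u_{i+1/2−}), U_{i+1/2R} = (h_{i+1/2R}, h_{i+1/2R}·u_{i+1/2+}), modified fluxes F_{i+1/2L} = F(U_{i+1/2L}, U_{i+1/2R}) + (0, g/2·(h_{i+1/2−}² − h_{i+1/2L}²)), F_{i−1/2R} = F(U_{i−1/2L}, U_{i−1/2R}) + (0, g/2·(h_{i−1/2+}² − h_{i−1/2R}²)), centered source Fcᵢ = (0, −g·(h_{i−1/2+} + h_{i+1/2−})/2·(z_{i+1/2−} − z_{i−1/2+})), and update Uᵢ* = Uᵢⁿ − (Δt/Δx)·(F_{i+1/2L} − F_{i−1/2R} − Fcᵢ) where Uᵢⁿ = (hᵢ, hᵢuᵢ). Then Uᵢ* = Uᵢⁿ for every i ∈ ℤ. -/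
/-- The hydrostatically reconstructed height of the lake at rest at level `C` over ground level `a`,
seen from an interface at level `m ≥ a`, is the lake height over the interface. -/
theorem reconstructed_height_of_lake_at_rest {C a m : ℝ} (ham : a ≤ m) :
    max (max (C - a) 0 + a - m) 0 = max (C - m) 0 := by
  grind


/-- The first-order hydrostatic reconstruction finite volume scheme exactly preserves
every lake-at-rest steady state `h = max (C - z) 0`, `u = 0`, including dry zones. -/
theorem hydrostatic_reconstruction_first_order_well_balanced
    (g Δt Δx : ℝ) (hg : 0 < g) (hΔt : 0 < Δt) (hΔx : 0 < Δx)
    (F : ℝ × ℝ → ℝ × ℝ → ℝ × ℝ)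
    (hF : ∀ (h u : ℝ), 0 ≤ h → F (h, h * u) (h, h * u) = (h * u, h * u ^ 2 + g * h ^ 2 / 2))
    (z : ℤ → ℝ) (C : ℝ)
    (h u : ℤ → ℝ)
    (hh : ∀ i, h i = max (C - z i) 0)
    (hu : ∀ i, u i = 0)
    -- hydrostatically reconstructed heights at interface i+1/2, with first-order
    -- interface values (h_{i+1/2-}, u_{i+1/2-}, z_{i+1/2-}) = (h i, u i, z i) and
    -- (h_{i+1/2+}, u_{i+1/2+}, z_{i+1/2+}) = (h (i+1), u (i+1), z (i+1))
    (hL hR : ℤ → ℝ)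
    (hhL : ∀ i, hL i = max (h i + z i - max (z i) (z (i + 1))) 0)
    (hhR : ∀ i, hR i = max (h (i + 1) + z (i + 1) - max (z i) (z (i + 1))) 0)
    -- reconstructed states at interface i+1/2
    (UL UR : ℤ → ℝ × ℝ)
    (hUL : ∀ i, UL i = (hL i, hL i * u i))
    (hUR : ∀ i, UR i = (hR i, hR i * u (i + 1)))
    -- modified fluxes: FL i is F_{i+1/2L}, FR i is F_{i-1/2R}
    (FL FR : ℤ → ℝ × ℝ)
    (hFL : ∀ i, FL i = F (UL i) (UR i) + (0, g / 2 * ((h i) ^ 2 - (hL i) ^ 2)))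
    (hFR : ∀ i, FR i = F (UL (i - 1)) (UR (i - 1)) + (0, g / 2 * ((h i) ^ 2 - (hR (i - 1)) ^ 2)))
    -- centered source term (first order: h_{i-1/2+} = h_{i+1/2-} = h i,
    -- z_{i+1/2-} = z_{i-1/2+} = z i)
    (Fc : ℤ → ℝ × ℝ)
    (hFc : ∀ i, Fc i = (0, -g * ((h i + h i) / 2) * (z i - z i)))
    -- cell states and update
    (Un Ustar : ℤ → ℝ × ℝ)
    (hUn : ∀ i, Un i = (h i, h i * u i))
    (hUstar : ∀ i, Ustar i = Un i - (Δt / Δx) • (FL i - FR i - Fc i)) :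
    ∀ i : ℤ, Ustar i = Un i := by
  intro i
  have hL_eq : ∀ j, hL j = max (C - max (z j) (z (j + 1))) 0 := fun j => by
    rw [hhL, hh, reconstructed_height_of_lake_at_rest (le_max_left _ _)]
  have hR_eq : ∀ j, hR j = hL j := fun j => by
    rw [hhR, hh, reconstructed_height_of_lake_at_rest (le_max_right _ _), hL_eq]
  have flux_eq : ∀ j, F (UL j) (UR j) = (0, g * hL j ^ 2 / 2) := fun j => by
    have hL_nonneg : 0 ≤ hL j := hL_eq j ▸ le_max_right _ _
    simpa [hUL, hUR, hR_eq, hu] using hF (hL j) 0 hL_nonneg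
  have balance : FL i - FR i - Fc i = 0 := by
    rw [hFL, hFR, hFc, flux_eq, flux_eq, hR_eq]
    ext
    · simp
    · simp only [Prod.snd_sub, Prod.snd_add, Prod.snd_zero]
      ring
  rw [hUstar, balance, smul_zero, sub_zero]
end

section
/- The hydrostatic reconstruction scheme combined with ANY interface reconstruction that preserves the lake-at-rest structure is well-balanced. Precisely: let g > 0, Δt, Δx > 0, let F : ℝ² × ℝ² → ℝ² be a numerical flux which is consistent, i.e. F((h, h·u), (h, h·u)) = (h·u, h·u² + g·h²/2) for all h ≥ 0 and u ∈ ℝ. Let C ∈ ℝ and suppose for each i ∈ ℤ we are given interface values satisfying u_{i+1/2−} = u_{i+1/2+} = 0, h_{i+1/2−} ≥ 0, h_{i+1/2+} ≥ 0, and h_{i+1/2−} + z_{i+1/2−} = h_{i+1/2+} + z_{i+1/2+} = C (fully wet lake at rest), and suppose the cell values are hᵢ > 0 with uᵢ = 0. Define the hydrostatically reconstructed heights h_{i+1/2L} = max(h_{i+1/2−} + z_{i+1/2−} − max(z_{i+1/2−}, z_{i+1/2+}), 0) and h_{i+1/2R} = max(h_{i+1/2+} + z_{i+1/2+} − max(z_{i+1/2−},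 z_{i+1/2+}), 0), reconstructed states U_{i+1/2L} = (h_{i+1/2L}, h_{i+1/2L}·u_{i+1/2−}), U_{i+1/2R} = (h_{i+1/2R}, h_{i+1/2R}·u_{i+1/2+}), modified fluxes F_{i+1/2L} = F(U_{i+1/2L}, U_{i+1/2R}) + (0, g/2·(h_{i+1/2−}² − h_{i+1/2L}²)), F_{i−1/2R} = F(U_{i−1/2L}, U_{i−1/2R}) + (0, g/2·(h_{i−1/2+}² − h_{i−1/2R}²)), centered source Fcᵢ = (0, −g·(h_{i−1/2+} + h_{i+1/2−})/2·(z_{i+1/2−} − z_{i−1/2+})). Then F_{i+1/2L} − F_{i−1/2R} − Fcᵢ = (0, 0) for every i ∈ ℤ, hence the update Uᵢ* = Uᵢⁿ − (Δt/Δx)·(F_{i+1/2L} − F_{i−1/2R} − Fcᵢ) satisfies Uᵢ* = Uᵢⁿ. -/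
/-- The hydrostatic reconstruction scheme combined with ANY interface reconstruction
preserving the fully wet lake-at-rest structure (`u = 0`, `h + z = C` at all interface
values) is well-balanced: the flux balance vanishes and the update is the identity. -/
theorem hydrostatic_reconstruction_high_order_well_balanced
    (g Δt Δx : ℝ) (hg : 0 < g) (hΔt : 0 < Δt) (hΔx : 0 < Δx)
    (F : ℝ × ℝ → ℝ × ℝ → ℝ × ℝ)
    (hF : ∀ (h u : ℝ), 0 ≤ h → F (h, h * u) (h, h * u) = (h * u, h * u ^ 2 + g * h ^ 2 / 2))
    (C : ℝ)
    -- interface values at interface i+1/2: hm i = h_{i+1/2-}, hp i = h_{i+1/2+}, etc.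
    (hm hp um up zm zp : ℤ → ℝ)
    (hum : ∀ i, um i = 0) (hup : ∀ i, up i = 0)
    (hhm : ∀ i, 0 ≤ hm i) (hhp : ∀ i, 0 ≤ hp i)
    (hwetm : ∀ i, hm i + zm i = C) (hwetp : ∀ i, hp i + zp i = C)
    -- cell values
    (hcell ucell : ℤ → ℝ)
    (hhcell : ∀ i, 0 < hcell i) (hucell : ∀ i, ucell i = 0)
    -- hydrostatically reconstructed heights at interface i+1/2
    (hL hR : ℤ → ℝ)
    (hhL : ∀ i, hL i = max (hm i + zm i - max (zm i) (zp i)) 0)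
    (hhR : ∀ i, hR i = max (hp i + zp i - max (zm i) (zp i)) 0)
    -- reconstructed states at interface i+1/2
    (UL UR : ℤ → ℝ × ℝ)
    (hUL : ∀ i, UL i = (hL i, hL i * um i))
    (hUR : ∀ i, UR i = (hR i, hR i * up i))
    -- modified fluxes: FL i is F_{i+1/2L}, FR i is F_{i-1/2R}
    -- (h_{i-1/2+} = hp (i-1), h_{i-1/2R} = hR (i-1), z_{i-1/2+} = zp (i-1))
    (FL FR : ℤ → ℝ × ℝ)
    (hFL : ∀ i, FL i = F (UL i) (UR i) + (0, g / 2 * ((hm i) ^ 2 - (hL i) ^ 2)))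
    (hFR : ∀ i, FR i = F (UL (i - 1)) (UR (i - 1))
        + (0, g / 2 * ((hp (i - 1)) ^ 2 - (hR (i - 1)) ^ 2)))
    -- centered source term
    (Fc : ℤ → ℝ × ℝ)
    (hFc : ∀ i, Fc i = (0, -g * ((hp (i - 1) + hm i) / 2) * (zm i - zp (i - 1))))
    -- cell states and update
    (Un Ustar : ℤ → ℝ × ℝ)
    (hUn : ∀ i, Un i = (hcell i, hcell i * ucell i))
    (hUstar : ∀ i, Ustar i = Un i - (Δt / Δx) • (FL i - FR i - Fc i)) :
    ∀ i : ℤ, FL i - FR i - Fc i = (0, 0) ∧ Ustar i = Un i := by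
  have flux_eq (i : ℤ) : hL i = hR i ∧ F (UL i) (UR i) = (0, g * hL i ^ 2 / 2) := by
    have hLR : hL i = hR i := by rw [hhL, hhR, hwetm, hwetp]
    have hL_nonneg : 0 ≤ hL i := by
      rw [hhL]
      exact le_max_right _ _
    refine ⟨hLR, ?_⟩
    rw [hUL, hUR, hum, hup, ← hLR, hF _ _ hL_nonneg]
    simp
  intro i
  have balance : FL i - FR i - Fc i = (0, 0) := by
    obtain ⟨-, hflux⟩ := flux_eq i
    obtain ⟨hLR', hflux'⟩ := flux_eq (i - 1)
    have hzm : zm i = C - hm i := eq_sub_of_add_eq' (hwetm i)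
    have hzp : zp (i - 1) = C - hp (i - 1) := eq_sub_of_add_eq' (hwetp (i - 1))
    rw [hFL, hFR, hFc, hflux, hflux', hLR', hzm, hzp]
    ext
    · simp
    · simp only [Prod.snd_sub, Prod.snd_add]
      ring
  refine ⟨balance, ?_⟩
  rw [hUstar, balance, Prod.mk_zero_zero, smul_zero, sub_zero]
end
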